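/- arXiv:2208.02704 — 2 statements merged into one kernel-verified Lean document; each statement's English description precedes it below -/
import Mathlib

section
/- Let X be a nonempty set, let f, m, σ : X → ℝ, and let β ≥ 0. Assume the confidence interval condition |f(x) − m(x)| ≤ β·σ(x) holds for all x ∈ X. Let x⋆ ∈ X be a global minimizer of f (f(x⋆) ≤ f(x) for all x ∈ X), and let x₊ ∈ X be a global minimizer over X of the lower confidence bound LCB(x) = m(x) − β·σ(x) (LCB(x₊) ≤ LCB(x) for all x ∈ X). Then the instantaneous regret satisfies f(x₊) − f(x⋆) ≤ 2·β·σ(x₊). -/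
/-- LCB instantaneous regret bound (Lemma 1, LCB part). -/
theorem lcb_instantaneous_regret {X : Type*} [Nonempty X]
    (f m σ : X → ℝ) (β : ℝ) (hβ : 0 ≤ β)
    (hconf : ∀ x, |f x - m x| ≤ β * σ x)
    (xstar xplus : X)
    (hstar : ∀ x, f xstar ≤ f x)
    (hplus : ∀ x, m xplus - β * σ xplus ≤ m x - β * σ x) :
    f xplus - f xstar ≤ 2 * β * σ xplus := by
  have upper := (abs_le.mp (hconf xplus)).2
  have lower := (abs_le.mp (hconf xstar)).1
  linarith [hplus xstar]
end

section
/- Let ϕ(z) = (2π)^{-1/2}·exp(−z²/2) denote the standard normal density, Φ(z) = ∫_{−∞}^{z} ϕ(t) dt the standard normal CDF, and define τ(z) = z·Φ(z) + ϕ(z). Let X be a set, m, σ : X → ℝ with σ(x) > 0 for all x, and let m⁻ ∈ ℝ satisfy m⁻ ≤ m(x) for all x ∈ X. Define z(x) = (m⁻ − m(x))/σ(x) and EI(x) = σ(x)·τ(z(x)). Then for every x ∈ X, EI(x) ≤ σ(x)/√(2π) < σ(x). -/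
open MeasureTheory

/-- Standard normal density. -/
noncomputable def stdNormalPDF (z : ℝ) : ℝ :=
  (Real.sqrt (2 * Real.pi))⁻¹ * Real.exp (-z ^ 2 / 2)

/-- Standard normal CDF. -/
noncomputable def stdNormalCDF (z : ℝ) : ℝ :=
  ∫ t in Set.Iic z, stdNormalPDF t

/-- The function τ(z) = z·Φ(z) + ϕ(z) from the Expected Improvement closed form. -/
noncomputable def tauEI (z : ℝ) : ℝ :=
  z * stdNormalCDF z + stdNormalPDF z

theorem stdNormalPDF_nonneg (z : ℝ) : 0 ≤ stdNormalPDF z := by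
  unfold stdNormalPDF
  positivity

theorem stdNormalPDF_le (z : ℝ) : stdNormalPDF z ≤ (Real.sqrt (2 * Real.pi))⁻¹ :=
  mul_le_of_le_one_right (by positivity)
    (Real.exp_le_one_iff.mpr (by nlinarith [sq_nonneg z]))

theorem stdNormalCDF_nonneg (z : ℝ) : 0 ≤ stdNormalCDF z :=
  integral_nonneg stdNormalPDF_nonneg

theorem tauEI_le_of_nonpos {z : ℝ} (hz : z ≤ 0) : tauEI z ≤ (Real.sqrt (2 * Real.pi))⁻¹ := by
  have h := mul_nonpos_of_nonpos_of_nonneg hz (stdNormalCDF_nonneg z)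
  have h' := stdNormalPDF_le z
  unfold tauEI
  linarith

theorem one_lt_sqrt_two_pi : 1 < Real.sqrt (2 * Real.pi) :=
  Real.lt_sqrt_of_sq_lt (by linarith [Real.pi_gt_three])

/-- Upper bound on the Expected Improvement: EI(x) ≤ σ(x)/√(2π) < σ(x). -/
theorem EI_upper_bound {X : Type*} (m σ : X → ℝ) (hσ : ∀ x, 0 < σ x)
    (mminus : ℝ) (hm : ∀ x, mminus ≤ m x) :
    ∀ x : X,
      σ x * tauEI ((mminus - m x) / σ x) ≤ σ x / Real.sqrt (2 * Real.pi) ∧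
      σ x / Real.sqrt (2 * Real.pi) < σ x := by
  intro x
  refine ⟨?_, div_lt_self (hσ x) one_lt_sqrt_two_pi⟩
  rw [div_eq_mul_inv (σ x)]
  exact mul_le_mul_of_nonneg_left
    (tauEI_le_of_nonpos (div_nonpos_of_nonpos_of_nonneg (sub_nonpos.mpr (hm x)) (hσ x).le))
    (hσ x).le
end
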